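/- Let α > 1 be an irrational real number. Then as t → 0⁺, L_α(t) − L_α(2t) = π²/(12αt) − ((1 − α^{−1})/2)·log 2 + o(1). -/

import Mathlib

open Filter Topology Real Asymptotics

/-- `L_α(t) = -∑_{ℓ ≥ 1} log(1 - e^{-t⌊αℓ⌋})`. -/
noncomputable def LBeatty (α : ℝ) (t : ℝ) : ℝ :=
  -∑' ℓ : ℕ, Real.log (1 - Real.exp (-t * (⌊α * (ℓ + 1)⌋ : ℤ)))

lemma exists_large_den (β : ℝ) (hβ : Irrational β) (Q : ℕ) :
    ∃ r : ℚ, |β - r| < 1 / (r.den : ℝ) ^ 2 ∧ Q < r.den := by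
  by_contra! h
  have hinf := Real.infinite_rat_abs_sub_lt_one_div_den_sq_of_irrational hβ
  apply hinf
  set B : ℤ := ⌈(|β| + 1) * Q⌉
  have hfin : ((Set.Icc (-B) B) ×ˢ (Set.Iic Q) : Set (ℤ × ℕ)).Finite :=
    (Set.finite_Icc _ _).prod (Set.finite_Iic _)
  have hinj : Function.Injective (fun r : ℚ => (r.num, r.den)) := by
    intro a b hab
    simp only [Prod.mk_inj] at hab
    rw [← Rat.num_div_den a, ← Rat.num_div_den b, hab.1, hab.2]
  refine (hfin.preimage hinj.injOn).subset ?_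
  intro r hr
  have hr' : |β - r| < 1 / (r.den : ℝ) ^ 2 := hr
  have hQ := h r hr'
  have hd : (1 : ℝ) ≤ r.den := by exact_mod_cast r.den_pos
  have h1 : 1 / (r.den : ℝ) ^ 2 ≤ 1 := by
    rw [div_le_one (by positivity)]; nlinarith
  have h2 : |(r : ℝ)| ≤ |β| + 1 := by
    have := abs_sub_abs_le_abs_sub (r : ℝ) β
    rw [abs_sub_comm] at this
    linarith
  have h3 : (r.num : ℝ) = r * r.den := by
    have := Rat.mul_den_eq_num r
    exact_mod_cast this.symm
  have h4 : |(r.num : ℝ)| ≤ B := by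
    rw [h3, abs_mul, abs_of_nonneg (by positivity : (0:ℝ) ≤ r.den)]
    refine le_trans ?_ (Int.le_ceil _)
    have : (r.den : ℝ) ≤ Q := by exact_mod_cast hQ
    gcongr
  have h5 : |r.num| ≤ B := by exact_mod_cast h4
  simp only [Set.mem_preimage, Set.mem_prod, Set.mem_Icc, Set.mem_Iic]
  exact ⟨abs_le.mp h5, hQ⟩

lemma fract_sum_rat (p : ℤ) (q : ℕ) (hq : 0 < q) (hc : p.natAbs.Coprime q) (y : ℝ) :
    |∑ l ∈ Finset.range q, Int.fract (y + l * (p / q : ℝ)) - q / 2| ≤ 1 := by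
  have hq' : (0 : ℝ) < q := by exact_mod_cast hq
  have hqz : (0 : ℤ) < q := by exact_mod_cast hq
  set n : ℤ := ⌊q * y⌋
  set s : ℝ := Int.fract (q * y)
  have hs0 : 0 ≤ s := Int.fract_nonneg _
  have hs1 : s < 1 := Int.fract_lt_one _
  have hy : (n : ℝ) + s = q * y := Int.floor_add_fract _
  have key : ∀ l : ℕ, Int.fract (y + l * (p / q : ℝ)) =
      ((((n + l * p) % (q:ℤ)).toNat : ℕ) : ℝ) / q + s / q := by
    intro l
    have hnn : 0 ≤ (n + l * p) % (q:ℤ) := Int.emod_nonneg _ hqz.ne'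
    have hlt : (n + l * p) % (q:ℤ) < q := Int.emod_lt_of_pos _ hqz
    have hcast : ((((n + l * p) % (q:ℤ)).toNat : ℕ) : ℝ) = (((n + l * p) % (q:ℤ) : ℤ) : ℝ) := by
      have : ((((n + l * p) % (q:ℤ)).toNat : ℕ) : ℤ) = (n + l * p) % (q:ℤ) := Int.toNat_of_nonneg hnn
      exact_mod_cast this
    rw [hcast]
    set e := (n + l * p) % (q:ℤ)
    have hde : (q : ℤ) * ((n + l * p) / (q:ℤ)) + e = n + l * p := Int.mul_ediv_add_emod _ _
    have hde' : (q : ℝ) * (((n + l * p) / (q:ℤ) : ℤ) : ℝ) + (e : ℝ) = n + l * p := by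
      exact_mod_cast hde
    rw [Int.fract_eq_iff]
    have he0 : (0 : ℝ) ≤ e := by exact_mod_cast hnn
    have he1 : (e : ℝ) + 1 ≤ q := by exact_mod_cast hlt
    refine ⟨by positivity, ?_, (n + l * p) / (q:ℤ), ?_⟩
    · rw [← add_div, div_lt_one hq']; linarith
    · field_simp
      linarith
  rw [Finset.sum_congr rfl (fun l _ => key l)]
  have hbij : ∑ l ∈ Finset.range q, (((((n + l * p) % (q:ℤ)).toNat : ℕ) : ℝ) / q + s / q)
      = ∑ j ∈ Finset.range q, ((j : ℝ) / q + s / q) := by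
    have hmaps : ∀ l ∈ Finset.range q, ((n + l * p) % (q:ℤ)).toNat ∈ Finset.range q := by
      intro l _
      have hlt : (n + l * p) % (q:ℤ) < q := Int.emod_lt_of_pos _ hqz
      have hnn : 0 ≤ (n + l * p) % (q:ℤ) := Int.emod_nonneg _ hqz.ne'
      rw [Finset.mem_range]; omega
    have hinj : Set.InjOn (fun l : ℕ => ((n + l * p) % (q:ℤ)).toNat) (Finset.range q) := by
      intro a ha b hb hab
      simp only [Finset.coe_range, Set.mem_Iio] at ha hb
      have h1 : 0 ≤ (n + a * p) % (q:ℤ) := Int.emod_nonneg _ hqz.ne'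
      have h2 : 0 ≤ (n + b * p) % (q:ℤ) := Int.emod_nonneg _ hqz.ne'
      have h3 : (n + a * p) % (q:ℤ) = (n + b * p) % (q:ℤ) := by
        dsimp only at hab; omega
      have h4 : (q : ℤ) ∣ (b - a : ℤ) * p := by
        have := (Int.emod_emod_of_dvd 0 (dvd_refl (q:ℤ)))
        have h5 := Int.ModEq.dvd (show (n + a * p) ≡ (n + b * p) [ZMOD q] from h3)
        have h6 : (b - a : ℤ) * p = n + b * p - (n + a * p) := by ring
        rw [h6]; exact h5
      have h7 : IsCoprime (q : ℤ) p := by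
        rw [Int.isCoprime_iff_gcd_eq_one, Int.gcd_comm]
        simpa [Int.gcd] using hc
      have h8 := h7.dvd_of_dvd_mul_right h4
      have h9 : (b - a : ℤ) = 0 := by
        apply Int.eq_zero_of_abs_lt_dvd h8
        rw [abs_lt]; constructor <;> omega
      omega
    refine Finset.sum_bij (fun l _ => ((n + l * p) % (q:ℤ)).toNat) hmaps
      (fun a ha b hb h => hinj (by simpa using ha) (by simpa using hb) h) ?_ (fun _ _ => rfl)
    have := Finset.surjOn_of_injOn_of_card_le _ hmaps hinj le_rfl
    intro j hj
    obtain ⟨l, hl, h⟩ := this (by simpa using hj)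
    exact ⟨l, by simpa using hl, h⟩
  rw [hbij, Finset.sum_add_distrib, ← Finset.sum_div, Finset.sum_const, Finset.card_range]
  have hsum : (∑ j ∈ Finset.range q, (j : ℝ)) = q * (q - 1) / 2 := by
    clear hbij key
    have := Finset.sum_range_id_mul_two q
    have h2 : ((∑ j ∈ Finset.range q, j : ℕ) : ℝ) * 2 = q * (q - 1) := by
      rw [← Nat.cast_pred hq]
      exact_mod_cast this
    push_cast at h2
    linarith
  rw [hsum, nsmul_eq_mul]
  have : (q * (q - 1) / 2 / q + q * (s / q) - q / 2 : ℝ) = s - 1 / 2 := by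
    field_simp; ring
  rw [this, abs_le]; constructor <;> linarith

lemma fract_block (β : ℝ) (r : ℚ) (hr : |β - r| < 1 / (r.den : ℝ) ^ 2) (x : ℝ) :
    |∑ l ∈ Finset.range r.den, Int.fract (x + l * β) - r.den / 2| ≤ 3 := by
  set q := r.den
  have hq : 0 < q := r.den_pos
  have hq' : (0 : ℝ) < q := by exact_mod_cast hq
  have hrr : (r : ℝ) = (r.num : ℝ) / q := by
    have := Rat.num_div_den r
    exact_mod_cast this.symm
  have hlo := fract_sum_rat r.num q hq r.reduced (x - 1 / q)
  have hhi := fract_sum_rat r.num q hq r.reduced (x + 1 / q)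
  rw [← hrr] at hlo hhi
  have hdev : ∀ l ∈ Finset.range q, |(l : ℝ) * β - l * r| ≤ 1 / q := by
    intro l hl
    have hl' : (l : ℝ) ≤ q := by exact_mod_cast (Finset.mem_range.mp hl).le
    rw [← mul_sub, abs_mul, abs_of_nonneg (by positivity : (0:ℝ) ≤ l)]
    calc (l : ℝ) * |β - r| ≤ q * (1 / (q:ℝ)^2) := by gcongr
      _ = 1 / q := by field_simp
  have h1 : ∀ l ∈ Finset.range q, Int.fract (x + l * β) ≤ Int.fract (x - 1 / q + l * r) + 2 / q := by
    intro l hl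
    have := abs_le.mp (hdev l hl)
    have hfl : ⌊x - 1 / q + l * r⌋ ≤ ⌊x + l * β⌋ := Int.floor_le_floor (by linarith)
    have hfl' : (⌊x - 1 / q + l * r⌋ : ℝ) ≤ ⌊x + l * β⌋ := by exact_mod_cast hfl
    simp only [Int.fract]
    have : (2 : ℝ) / q = 1 / q + 1 / q := by ring
    linarith
  have h2 : ∀ l ∈ Finset.range q, Int.fract (x + 1 / q + l * r) - 2 / q ≤ Int.fract (x + l * β) := by
    intro l hl
    have := abs_le.mp (hdev l hl)
    have hfl : ⌊x + l * β⌋ ≤ ⌊x + 1 / q + l * r⌋ := Int.floor_le_floor (by linarith)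
    have hfl' : (⌊x + l * β⌋ : ℝ) ≤ ⌊x + 1 / q + l * r⌋ := by exact_mod_cast hfl
    simp only [Int.fract]
    have : (2 : ℝ) / q = 1 / q + 1 / q := by ring
    linarith
  have s1 := Finset.sum_le_sum h1
  have s2 := Finset.sum_le_sum h2
  rw [Finset.sum_add_distrib, Finset.sum_const, Finset.card_range, nsmul_eq_mul] at s1
  rw [Finset.sum_sub_distrib, Finset.sum_const, Finset.card_range, nsmul_eq_mul] at s2
  have e : (q : ℝ) * (2 / q) = 2 := by field_simp
  rw [e] at s1 s2
  have a1 := abs_le.mp hlo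
  have a2 := abs_le.mp hhi
  rw [abs_le]; constructor <;> linarith

lemma fract_partial (β : ℝ) (hβ : Irrational β) (ε : ℝ) (hε : 0 < ε) :
    ∃ K : ℝ, 0 ≤ K ∧ ∀ M : ℕ,
      |∑ k ∈ Finset.range M, (Int.fract ((k + 1) * β) - 1 / 2)| ≤ ε * M + K := by
  obtain ⟨Q, hQ⟩ := exists_nat_gt (3 / ε)
  obtain ⟨r, hr, hrQ⟩ := exists_large_den β hβ Q
  have hq : 0 < r.den := r.den_pos
  have hq' : (0 : ℝ) < r.den := by exact_mod_cast hq
  have h3 : 3 ≤ ε * r.den := by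
    have : (Q : ℝ) < r.den := by exact_mod_cast hrQ
    have h := hQ.trans this
    rw [div_lt_iff₀ hε] at h
    linarith
  refine ⟨r.den, hq'.le, fun M => ?_⟩
  induction M using Nat.strong_induction_on with
  | _ M ih =>
    by_cases hM : M < r.den
    · have hM' : (M : ℝ) ≤ r.den := by exact_mod_cast hM.le
      calc |∑ k ∈ Finset.range M, (Int.fract ((k + 1) * β) - 1 / 2)|
          ≤ ∑ k ∈ Finset.range M, |Int.fract ((k + 1) * β) - 1 / 2| := Finset.abs_sum_le_sum_abs _ _
        _ ≤ ∑ k ∈ Finset.range M, (1 : ℝ) := by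
            refine Finset.sum_le_sum fun k _ => ?_
            have h0 := Int.fract_nonneg ((k + 1) * β)
            have h1 := Int.fract_lt_one ((k + 1) * β)
            rw [abs_le]; constructor <;> linarith
        _ = M := by simp
        _ ≤ ε * M + r.den := by nlinarith [(Nat.cast_nonneg M : (0:ℝ) ≤ M)]
    · push Not at hM
      obtain ⟨N, rfl⟩ := Nat.exists_eq_add_of_le' hM
      have h := ih N (by omega)
      rw [Finset.sum_range_add]
      have hb := fract_block β r hr ((N + 1) * β)
      have e : ∑ k ∈ Finset.range r.den, (Int.fract ((((N + k : ℕ) : ℝ) + 1) * β) - 1 / 2)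
          = ∑ l ∈ Finset.range r.den, Int.fract ((N + 1) * β + l * β) - r.den / 2 := by
        rw [Finset.sum_sub_distrib, Finset.sum_const, Finset.card_range, nsmul_eq_mul]
        congr 1
        · refine Finset.sum_congr rfl fun k _ => ?_
          congr 1; push_cast; ring
        · ring
      rw [e]
      refine (abs_add_le _ _).trans ?_
      push_cast
      linarith

lemma abel_count (φ : ℕ → ℝ) (hφ : Antitone φ) (h0 : Tendsto φ atTop (𝓝 0))
    (a N : ℕ → ℕ) (haN : ∀ l m, a l ≤ m ↔ l < N m) (hs : Summable fun l => φ (a l)) :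
    HasSum (fun m => (N m : ℝ) * (φ m - φ (m + 1))) (∑' l, φ (a l)) := by
  set D : ℕ → ℝ := fun m => φ m - φ (m + 1)
  have hD : ∀ m, 0 ≤ D m := fun m => sub_nonneg.mpr (hφ (Nat.le_succ m))
  have htail : ∀ k, HasSum (fun m => if k ≤ m then D m else 0) (φ k) := by
    intro k
    rw [hasSum_iff_tendsto_nat_of_nonneg (fun m => by split_ifs <;> simp [hD])]
    have hfin : ∀ n, ∑ m ∈ Finset.range n, (if k ≤ m then D m else 0) = φ k - φ (max k n) := by
      intro n
      induction n with
      | zero => simp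
      | succ n ih =>
        rw [Finset.sum_range_succ, ih]
        split_ifs with h
        · rw [max_eq_right h, max_eq_right (by omega)]; simp [D]
        · rw [max_eq_left (by omega), max_eq_left (by omega)]; simp
    simp_rw [hfin]
    have : Tendsto (fun n => φ (max k n)) atTop (𝓝 0) :=
      h0.comp (tendsto_atTop_mono (fun n => le_max_right k n) tendsto_id)
    simpa using this.const_sub (φ k)
  have hsum : Summable (fun z : ℕ × ℕ => if a z.1 ≤ z.2 then D z.2 else 0) := by
    rw [summable_prod_of_nonneg (fun z => by dsimp only; split_ifs <;> simp [hD])]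
    refine ⟨fun l => (htail (a l)).summable, ?_⟩
    simpa only [(htail _).tsum_eq] using hs
  have h1 : HasSum (fun z : ℕ × ℕ => if a z.1 ≤ z.2 then D z.2 else 0) (∑' l, φ (a l)) := by
    have := hsum.hasSum.prod_fiberwise (fun l => htail (a l))
    rw [this.tsum_eq]; exact hsum.hasSum
  have h2 := (Equiv.prodComm ℕ ℕ).hasSum_iff.mpr h1
  refine h2.prod_fiberwise (fun m => ?_)
  have : (fun c => ((fun z : ℕ × ℕ => if a z.1 ≤ z.2 then D z.2 else 0) ∘ (Equiv.prodComm ℕ ℕ)) (m, c))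
      = fun c => if c ∈ Finset.range (N m) then D m else 0 := by
    funext c
    simp [haN]
  rw [this]
  have h3 : HasSum (fun c => if c ∈ Finset.range (N m) then D m else 0)
      (∑ c ∈ Finset.range (N m), if c ∈ Finset.range (N m) then D m else 0) :=
    hasSum_sum_of_ne_finset_zero (fun b hb => if_neg hb)
  convert h3 using 1
  rw [Finset.sum_congr rfl (fun c hc => if_pos hc)]
  rw [Finset.sum_const, Finset.card_range, nsmul_eq_mul]

lemma abel_bound (c D : ℕ → ℝ) (hD : Antitone D) (hD0 : ∀ m, 0 ≤ D m) (ε K : ℝ)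
    (hc : ∀ M : ℕ, |∑ k ∈ Finset.range M, c k| ≤ ε * M + K) (M : ℕ) :
    |∑ m ∈ Finset.range M, c m * D m| ≤ ε * ∑ m ∈ Finset.range M, D m + K * D 0 := by
  have id1 : ∀ (c : ℕ → ℝ) (M : ℕ), ∑ m ∈ Finset.range M, c m * D m =
      (∑ k ∈ Finset.range M, c k) * D M
      + ∑ m ∈ Finset.range M, (∑ k ∈ Finset.range (m+1), c k) * (D m - D (m+1)) := by
    intro c M
    induction M with
    | zero => simp
    | succ n ih =>
      rw [Finset.sum_range_succ, ih, Finset.sum_range_succ (fun m => _ * (D m - D (m+1))),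
        Finset.sum_range_succ c]
      ring
  have id2 : ∀ M : ℕ, ε * ∑ m ∈ Finset.range M, D m + K * D 0 = (ε * M + K) * D M
      + ∑ m ∈ Finset.range M, (ε * ((m+1 : ℕ) : ℝ) + K) * (D m - D (m+1)) := by
    intro M
    induction M with
    | zero => simp
    | succ n ih =>
      rw [Finset.sum_range_succ, Finset.sum_range_succ]
      push_cast at ih ⊢
      linarith
  rw [id1, id2]
  refine (abs_add_le _ _).trans (add_le_add ?_ ?_)
  · rw [abs_mul, abs_of_nonneg (hD0 M)]
    exact mul_le_mul_of_nonneg_right (hc M) (hD0 M)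
  · refine (Finset.abs_sum_le_sum_abs _ _).trans (Finset.sum_le_sum fun m _ => ?_)
    have h := sub_nonneg.mpr (hD (Nat.le_succ m))
    rw [abs_mul, abs_of_nonneg h]
    exact mul_le_mul_of_nonneg_right (hc (m+1)) h

noncomputable def fB (x : ℝ) : ℝ := Real.log (1 + Real.exp (-x))
noncomputable def gB (x : ℝ) : ℝ := 1 / (1 + Real.exp x)

lemma fB_nonneg (x : ℝ) : 0 ≤ fB x := Real.log_nonneg (by have := Real.exp_pos (-x); linarith)

lemma fB_le (x : ℝ) : fB x ≤ Real.exp (-x) := by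
  have := Real.log_le_sub_one_of_pos (x := 1 + Real.exp (-x)) (by positivity)
  unfold fB; linarith

lemma fB_zero : fB 0 = Real.log 2 := by unfold fB; norm_num

lemma fB_anti : Antitone fB := by
  intro x y h
  unfold fB
  apply Real.log_le_log (by positivity)
  gcongr

lemma gB_anti : Antitone gB := by
  intro x y h
  unfold gB
  gcongr

lemma fB_deriv (x : ℝ) : HasDerivAt fB (- gB x) x := by
  have h1 : HasDerivAt (fun x : ℝ => 1 + Real.exp (-x)) (Real.exp (-x) * (-1)) x :=
    ((hasDerivAt_id x).neg.exp).const_add 1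
  have h2 := h1.log (by positivity)
  change HasDerivAt (fun y : ℝ => Real.log (1 + Real.exp (-y))) _ x
  convert h2 using 1
  unfold gB
  rw [Real.exp_neg]
  have := Real.exp_pos x
  field_simp
  ring

lemma fB_cont : Continuous fB :=
  continuous_iff_continuousAt.mpr fun x => (fB_deriv x).continuousAt

lemma fB_slope {x y : ℝ} (h : x ≤ y) :
    gB y * (y - x) ≤ fB x - fB y ∧ fB x - fB y ≤ gB x * (y - x) := by
  rcases h.eq_or_lt with rfl | h
  · simp
  obtain ⟨c, hc, e⟩ := exists_hasDerivAt_eq_slope fB (fun x => - gB x) h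
    fB_cont.continuousOn (fun x _ => fB_deriv x)
  have hxy : 0 < y - x := by linarith
  rw [eq_div_iff hxy.ne'] at e
  have h1 := gB_anti hc.1.le
  have h2 := gB_anti hc.2.le
  constructor <;> nlinarith

lemma trap (a t : ℝ) (ht : 0 ≤ t) :
    |t * (fB a + fB (a + t)) / 2 - ∫ x in a..(a+t), fB x| ≤ t ^ 2 / 4 * (gB a - gB (a + t)) := by
  set b := a + t with hb
  have hab : a ≤ b := by linarith
  have lin : ∀ u v : ℝ, ∫ x in a..b, (u + v * (x - a)) = u * t + v * (t ^ 2 / 2) := by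
    intro u v
    rw [intervalIntegral.integral_add (by simp) (Continuous.intervalIntegrable (by fun_prop) _ _),
      intervalIntegral.integral_const_mul, intervalIntegral.integral_comp_sub_right (fun x => x)]
    simp [hb]
    ring
  have hup : ∫ x in a..b, fB x ≤ ∫ x in a..b,
      (((fB a + fB b + gB a * t) / 2) + (-(gB a + gB b)/2) * (x - a)) := by
    refine intervalIntegral.integral_mono_on hab (fB_cont.intervalIntegrable _ _)
      (Continuous.intervalIntegrable (by fun_prop) _ _) ?_
    intro x hx
    have h1 := fB_slope hx.1
    have h2 := fB_slope hx.2
    have g1 := gB_anti hx.1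
    have g2 := gB_anti hx.2
    have e1 : 0 ≤ x - a := by linarith [hx.1]
    have e2 : 0 ≤ b - x := by linarith [hx.2]
    nlinarith [mul_le_mul_of_nonneg_right g2 e1, mul_le_mul_of_nonneg_right g1 e2]
  have hlo : ∫ x in a..b,
      (((fB a + fB b + gB b * t) / 2) + (-(gB a + gB b)/2) * (x - a)) ≤ ∫ x in a..b, fB x := by
    refine intervalIntegral.integral_mono_on hab 
      (Continuous.intervalIntegrable (by fun_prop) _ _) (fB_cont.intervalIntegrable _ _) ?_
    intro x hx
    have h1 := fB_slope hx.1
    have h2 := fB_slope hx.2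
    have g1 := gB_anti hx.1
    have g2 := gB_anti hx.2
    have e1 : 0 ≤ x - a := by linarith [hx.1]
    have e2 : 0 ≤ b - x := by linarith [hx.2]
    nlinarith [mul_le_mul_of_nonneg_right g1 e1, mul_le_mul_of_nonneg_right g2 e2]
  rw [lin] at hup hlo
  rw [abs_le]; constructor <;> nlinarith

lemma fB_integrable : MeasureTheory.IntegrableOn fB (Set.Ioi 0) := by
  have h := exp_neg_integrableOn_Ioi 0 (b := 1) one_pos
  refine MeasureTheory.Integrable.mono' h fB_cont.aestronglyMeasurable ?_
  refine Filter.Eventually.of_forall fun x => ?_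
  rw [Real.norm_of_nonneg (fB_nonneg x)]
  simpa using fB_le x

lemma hasSum_alt_two :
    HasSum (fun n : ℕ => (-1 : ℝ) ^ n / ((n : ℝ) + 1) ^ 2) (π ^ 2 / 12) := by
  have hz := hasSum_zeta_two
  have h1 : HasSum (fun n : ℕ => 1 / ((n : ℝ) + 1) ^ 2) (π ^ 2 / 6) := by
    have := (hasSum_nat_add_iff' 1).mpr hz
    simpa using this
  have h2 : HasSum (fun n : ℕ => 1 / ((2 * (n : ℝ) + 1) + 1) ^ 2) (π ^ 2 / 24) := by
    convert! h1.mul_left (1 / 4) using 1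
    · funext n
      field_simp
      ring
    · ring
  have hodd : HasSum (fun n : ℕ => if Odd n then 1 / ((n : ℝ) + 1) ^ 2 else 0) (π ^ 2 / 24) := by
    have hinj : Function.Injective (fun n : ℕ => 2 * n + 1) := fun a b h => by
      dsimp only at h; omega
    rw [← hinj.hasSum_iff]
    · convert h2 using 1
      funext n
      simp
    · intro x hx
      rw [if_neg]
      rintro ⟨k, hk⟩
      exact hx ⟨k, hk.symm⟩
  convert! h1.sub (hodd.mul_left 2) using 1
  · funext n
    rcases Nat.even_or_odd n with h | h
    · rw [h.neg_one_pow, if_neg (by simpa using h)]; ring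
    · rw [h.neg_one_pow, if_pos h]; ring
  · ring

lemma fB_integral : ∫ x in Set.Ioi (0:ℝ), fB x = π ^ 2 / 12 := by
  set F : ℕ → ℝ → ℝ := fun n x => (-1 : ℝ) ^ n / ((n : ℝ) + 1) * Real.exp (-((n : ℝ) + 1) * x)
  have hI : ∀ n : ℕ, ∫ x in Set.Ioi (0:ℝ), Real.exp (-((n : ℝ) + 1) * x) = 1 / ((n : ℝ) + 1) := by
    intro n
    have hn : (0 : ℝ) < (n : ℝ) + 1 := by positivity
    rw [integral_exp_mul_Ioi (by linarith)]
    rw [mul_zero, Real.exp_zero, neg_div_neg_eq]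
  have hint : ∀ n, MeasureTheory.Integrable (F n) (MeasureTheory.volume.restrict (Set.Ioi 0)) := by
    intro n
    exact (exp_neg_integrableOn_Ioi 0 (b := (n : ℝ) + 1) (by positivity)).const_mul _
  have hnorm : ∀ n, ∫ x in Set.Ioi (0:ℝ), ‖F n x‖ = 1 / ((n : ℝ) + 1) ^ 2 := by
    intro n
    have : ∀ x, ‖F n x‖ = 1 / ((n : ℝ) + 1) * Real.exp (-((n : ℝ) + 1) * x) := by
      intro x
      have hn : (0 : ℝ) < (n : ℝ) + 1 := by positivity
      simp only [F, norm_mul, norm_div, norm_pow, norm_neg, norm_one, one_pow,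
        Real.norm_of_nonneg hn.le, Real.norm_of_nonneg (Real.exp_pos _).le]
    simp_rw [this]
    rw [MeasureTheory.integral_const_mul, hI]
    field_simp
  have hsum : Summable fun n : ℕ => 1 / ((n : ℝ) + 1) ^ 2 := by
    have := (summable_nat_add_iff 1).mpr hasSum_zeta_two.summable
    simpa using this
  have key := MeasureTheory.hasSum_integral_of_summable_integral_norm hint
    (by simpa only [hnorm] using hsum)
  have e1 : ∀ n, ∫ x in Set.Ioi (0:ℝ), F n x = (-1 : ℝ) ^ n / ((n : ℝ) + 1) ^ 2 := by
    intro n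
    simp only [F]
    rw [MeasureTheory.integral_const_mul, hI]
    field_simp
  simp only [e1] at key
  rw [← key.unique hasSum_alt_two]
  refine MeasureTheory.setIntegral_congr_fun measurableSet_Ioi ?_
  intro x hx
  have hx' : (0:ℝ) < x := hx
  have hlt : |-Real.exp (-x)| < 1 := by
    rw [abs_neg, abs_of_pos (Real.exp_pos _)]
    rw [Real.exp_lt_one_iff]; linarith
  have h := (Real.hasSum_pow_div_log_of_abs_lt_one hlt).neg
  simp only [neg_neg, sub_neg_eq_add] at h
  change fB x = ∑' n, F n x
  unfold fB
  rw [← h.tsum_eq]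
  congr 1
  funext n
  simp only [F]
  rw [neg_pow, ← Real.exp_nat_mul]
  have : ((n + 1 : ℕ) : ℝ) * -x = -((n:ℝ) + 1) * x := by push_cast; ring
  rw [this]
  ring

lemma fB_summable (t : ℝ) (ht : 0 < t) (a : ℕ → ℕ) (ha : ∀ l, l ≤ a l) :
    Summable fun l : ℕ => fB (t * a l) := by
  have h : Summable fun l : ℕ => Real.exp (-t * l) := by
    have := Real.summable_exp_nat_mul_iff.mpr (show -t < 0 by linarith)
    simpa [mul_comm] using this
  refine Summable.of_nonneg_of_le (fun l => fB_nonneg _) (fun l => (fB_le _).trans ?_) h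
  apply Real.exp_le_exp.mpr
  have : (l : ℝ) ≤ a l := by exact_mod_cast ha l
  nlinarith

lemma fB_trap_total (t : ℝ) (ht : 0 < t) :
    |t * (∑' m : ℕ, fB (t * m) - Real.log 2 / 2) - π ^ 2 / 12| ≤ t ^ 2 / 8 := by
  have hs : Summable fun m : ℕ => fB (t * m) := fB_summable t ht id (fun _ => le_rfl)
  have hbound : ∀ M : ℕ, |t * (∑ m ∈ Finset.range M, fB (t * m) - fB 0 / 2 + fB (t * M) / 2)
      - ∫ x in (0:ℝ)..(t * M), fB x| ≤ t ^ 2 / 8 := by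
    intro M
    have h1 := intervalIntegral.sum_integral_adjacent_intervals (f := fB)
      (μ := MeasureTheory.volume) (a := fun k : ℕ => t * k) (n := M)
      (fun k _ => fB_cont.intervalIntegrable _ _)
    simp only [Nat.cast_zero, mul_zero] at h1
    rw [← h1]
    have h2 : t * (∑ m ∈ Finset.range M, fB (t * m) - fB 0 / 2 + fB (t * M) / 2)
        = ∑ m ∈ Finset.range M, t * (fB (t * m) + fB (t * (m + 1 : ℕ))) / 2 := by
      induction M with
      | zero => simp
      | succ n ih =>
        rw [Finset.sum_range_succ, Finset.sum_range_succ, ← ih]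
        · ring
        · exact intervalIntegral.sum_integral_adjacent_intervals (f := fB)
            (μ := MeasureTheory.volume) (a := fun k : ℕ => t * k) (n := n)
            (fun k _ => fB_cont.intervalIntegrable _ _) |>.trans (by simp)
    rw [h2, ← Finset.sum_sub_distrib]
    calc _ ≤ ∑ m ∈ Finset.range M, |t * (fB (t * m) + fB (t * (m + 1 : ℕ))) / 2
            - ∫ x in (t * m)..(t * (m + 1 : ℕ)), fB x| := Finset.abs_sum_le_sum_abs _ _
      _ ≤ ∑ m ∈ Finset.range M, t ^ 2 / 4 * (gB (t * m) - gB (t * (m + 1 : ℕ))) := by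
          refine Finset.sum_le_sum fun m _ => ?_
          have := trap (t * m) t ht.le
          have e : t * (m : ℝ) + t = t * (m + 1 : ℕ) := by push_cast; ring
          rwa [e] at this
      _ = t ^ 2 / 4 * (gB 0 - gB (t * M)) := by
          rw [← Finset.mul_sum, Finset.sum_range_sub' (fun m : ℕ => gB (t * m))]
          simp
      _ ≤ t ^ 2 / 8 := by
          have h0 : gB 0 = 1 / 2 := by unfold gB; norm_num
          have h1 : 0 ≤ gB (t * M) := by unfold gB; positivity
          rw [h0]
          nlinarith [sq_nonneg t]
  have hatTop : Tendsto (fun M : ℕ => t * (M : ℝ)) atTop atTop :=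
    tendsto_natCast_atTop_atTop.const_mul_atTop ht
  have l1 := MeasureTheory.intervalIntegral_tendsto_integral_Ioi 0 fB_integrable hatTop
  rw [fB_integral] at l1
  have l2 := hs.hasSum.tendsto_sum_nat
  have l3 := hs.tendsto_atTop_zero
  have lim := (((((l2.sub_const (fB 0 / 2)).add (l3.div_const 2)).const_mul t).sub l1)).abs
  have := le_of_tendsto' lim hbound
  simpa [fB_zero] using this

lemma LBeatty_diff (α : ℝ) (hα : 1 < α) (t : ℝ) (ht : 0 < t) :
    LBeatty α t - LBeatty α (2 * t) = ∑' l : ℕ, fB (t * (⌊α * (l + 1)⌋.toNat : ℕ)) := by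
  have hfl : ∀ l : ℕ, (l : ℤ) + 1 ≤ ⌊α * (l + 1)⌋ := by
    intro l
    rw [Int.le_floor]
    push_cast
    have : (0 : ℝ) ≤ l := by positivity
    nlinarith
  have hS : ∀ s : ℝ, 0 < s →
      Summable fun l : ℕ => Real.log (1 - Real.exp (-s * (⌊α * (l + 1)⌋ : ℤ))) := by
    intro s hs
    have h : Summable fun l : ℕ => Real.exp (-s * l) := by
      have := Real.summable_exp_nat_mul_iff.mpr (show -s < 0 by linarith)
      simpa [mul_comm] using this
    have h2 : Summable fun l : ℕ => Real.exp (-s * (⌊α * (l + 1)⌋ : ℤ)) := by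
      refine Summable.of_nonneg_of_le (fun l => (Real.exp_pos _).le) (fun l => ?_) h
      apply Real.exp_le_exp.mpr
      have : (l : ℝ) + 1 ≤ (⌊α * (l + 1)⌋ : ℤ) := by exact_mod_cast hfl l
      nlinarith
    simpa [sub_eq_add_neg] using Real.summable_log_one_add_of_summable h2.neg
  unfold LBeatty
  rw [neg_sub_neg, ← (hS (2 * t) (by linarith)).tsum_sub (hS t ht)]
  congr 1
  funext l
  have h1 := hfl l
  have hcast : ((⌊α * (l + 1)⌋.toNat : ℕ) : ℝ) = (⌊α * (l + 1)⌋ : ℤ) := by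
    have : ((⌊α * (l + 1)⌋.toNat : ℕ) : ℤ) = ⌊α * (l + 1)⌋ := Int.toNat_of_nonneg (by omega)
    exact_mod_cast this
  rw [hcast]
  set n : ℝ := ((⌊α * (l + 1)⌋ : ℤ) : ℝ) with hndef
  have hn : 1 ≤ n := by
    have : (l : ℝ) + 1 ≤ n := by rw [hndef]; exact_mod_cast h1
    have : (0 : ℝ) ≤ l := by positivity
    linarith
  have hy : Real.exp (-t * n) < 1 := by rw [Real.exp_lt_one_iff]; nlinarith
  have hy0 := Real.exp_pos (-t * n)
  have e : Real.exp (-(2 * t) * n) = Real.exp (-t * n) ^ 2 := by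
    rw [← Real.exp_nat_mul]; congr 1; push_cast; ring
  unfold fB
  rw [e, show -(t * n) = -t * n by ring]
  have : 1 - Real.exp (-t * n) ^ 2 = (1 - Real.exp (-t * n)) * (1 + Real.exp (-t * n)) := by ring
  rw [this, Real.log_mul (by linarith) (by linarith)]
  ring

lemma fB_conv (x t : ℝ) : fB (x + t) - fB (x + t + t) ≤ fB x - fB (x + t) := by
  have h : fB (x + t) + fB (x + t) ≤ fB x + fB (x + t + t) := by
    unfold fB
    rw [← Real.log_mul (by positivity) (by positivity), ← Real.log_mul (by positivity) (by positivity)]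
    apply Real.log_le_log (by positivity)
    have e1 : Real.exp (-(x + t)) = Real.exp (-x) * Real.exp (-t) := by
      rw [← Real.exp_add]; congr 1; ring
    have e2 : Real.exp (-(x + t + t)) = Real.exp (-x) * Real.exp (-t) * Real.exp (-t) := by
      rw [← Real.exp_add, ← Real.exp_add]; congr 1; ring
    rw [e1, e2]
    nlinarith [mul_nonneg (Real.exp_pos (-x)).le (sq_nonneg (1 - Real.exp (-t)))]
  linarith

lemma main_bound (α : ℝ) (hα : 1 < α) (hirr : Irrational α) (ε : ℝ) (hε : 0 < ε) :
    ∃ K : ℝ, 0 ≤ K ∧ ∀ t : ℝ, 0 < t →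
      |LBeatty α t - LBeatty α (2 * t) - (π ^ 2 / (12 * α * t) - (1 - α⁻¹) / 2 * Real.log 2)|
        ≤ ε * Real.log 2 + K * (Real.log 2 - fB t) + t / 8 := by
  have hα0 : 0 < α := by linarith
  obtain ⟨K, hK0, hK⟩ := fract_partial α⁻¹ (irrational_inv_iff.mpr hirr) ε hε
  refine ⟨K, hK0, fun t ht => ?_⟩
  rw [LBeatty_diff α hα t ht]
  set φ : ℕ → ℝ := fun m => fB (t * m) with hφdef
  set D : ℕ → ℝ := fun m => φ m - φ (m + 1) with hDdef
  have hφ : Antitone φ := by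
    intro a b h
    apply fB_anti
    have : (a : ℝ) ≤ b := by exact_mod_cast h
    nlinarith
  have hφs : Summable φ := fB_summable t ht id (fun _ => le_rfl)
  have hφ0 : Tendsto φ atTop (𝓝 0) := hφs.tendsto_atTop_zero
  have hD0 : ∀ m, 0 ≤ D m := fun m => sub_nonneg.mpr (hφ (Nat.le_succ m))
  have hDanti : Antitone D := by
    apply antitone_nat_of_succ_le
    intro m
    have := fB_conv (t * m) t
    simp only [hDdef, hφdef]
    have e1 : t * ((m + 1 : ℕ) : ℝ) = t * m + t := by push_cast; ring
    have e2 : t * ((m + 1 + 1 : ℕ) : ℝ) = t * m + t + t := by push_cast; ring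
    rw [e1, e2]
    exact this
  have hfl : ∀ l : ℕ, (l : ℤ) + 1 ≤ ⌊α * (l + 1)⌋ := by
    intro l
    rw [Int.le_floor]
    push_cast
    have : (0 : ℝ) ≤ l := by positivity
    nlinarith
  -- the two Abel summations
  have hA := abel_count φ hφ hφ0 (fun l => ⌊α * (l + 1)⌋.toNat) (fun m => ⌊((m : ℝ) + 1) * α⁻¹⌋₊)
    (by
      intro l m
      have h1 := hfl l
      have hne : α * ((l : ℝ) + 1) ≠ (m : ℝ) + 1 := by
        have := (hirr.mul_natCast (m := l + 1) (by omega)).ne_nat (m + 1)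
        exact_mod_cast this
      have e1 : (⌊α * ((l : ℝ) + 1)⌋.toNat ≤ m) ↔ ⌊α * ((l : ℝ) + 1)⌋ < (m : ℤ) + 1 := by omega
      rw [e1, Int.floor_lt, ← Nat.succ_le_iff, Nat.le_floor_iff (by positivity),
        ← div_eq_mul_inv, le_div_iff₀ hα0]
      push_cast
      rw [mul_comm _ α]
      exact ⟨le_of_lt, fun h => lt_of_le_of_ne h hne⟩)
    (fB_summable t ht _ (fun l => by have := hfl l; omega))
  have hB := abel_count φ hφ hφ0 id (fun m => m + 1) (fun l m => by simp [Nat.lt_succ_iff]) hφs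
  have hDs : HasSum D (Real.log 2) := by
    rw [hasSum_iff_tendsto_nat_of_nonneg hD0]
    simp only [hDdef, Finset.sum_range_sub']
    have := hφ0.const_sub (φ 0)
    simpa [hφdef, fB_zero] using this
  set S := ∑' m : ℕ, fB (t * m) with hSdef
  set F := ∑' l : ℕ, fB (t * (⌊α * (l + 1)⌋.toNat : ℕ)) with hFdef
  have hR : HasSum (fun m : ℕ => (Int.fract (((m : ℝ) + 1) * α⁻¹) - 1 / 2) * D m)
      (α⁻¹ * S - F - 1 / 2 * Real.log 2) := by
    have := ((hB.mul_left α⁻¹).sub hA).sub (hDs.mul_left (1 / 2))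
    convert! this using 1
    funext m
    have hfr : ((⌊((m : ℝ) + 1) * α⁻¹⌋₊ : ℕ) : ℝ)
        = ((m : ℝ) + 1) * α⁻¹ - Int.fract (((m : ℝ) + 1) * α⁻¹) := by
      rw [natCast_floor_eq_intCast_floor (by positivity), Int.self_sub_fract]
    rw [hfr]
    push_cast
    ring
  have hRb : |α⁻¹ * S - F - 1 / 2 * Real.log 2| ≤ ε * Real.log 2 + K * D 0 := by
    refine le_of_tendsto' hR.tendsto_sum_nat.abs fun M => ?_
    refine (abel_bound _ D hDanti hD0 ε K hK M).trans ?_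
    have := sum_le_hasSum (Finset.range M) (fun m _ => hD0 m) hDs
    gcongr
  have hD00 : D 0 = Real.log 2 - fB t := by simp [hDdef, hφdef, fB_zero]
  rw [hD00] at hRb
  have hT := fB_trap_total t ht
  rw [← hSdef] at hT
  have hT' : |S - Real.log 2 / 2 - π ^ 2 / (12 * t)| ≤ t / 8 := by
    have e : S - Real.log 2 / 2 - π ^ 2 / (12 * t)
        = (t * (S - Real.log 2 / 2) - π ^ 2 / 12) / t := by field_simp
    rw [e, abs_div, abs_of_pos ht, div_le_iff₀ ht]
    linarith
  have e : F - (π ^ 2 / (12 * α * t) - (1 - α⁻¹) / 2 * Real.log 2)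
      = -(α⁻¹ * S - F - 1 / 2 * Real.log 2) + α⁻¹ * (S - Real.log 2 / 2 - π ^ 2 / (12 * t)) := by
    field_simp
    ring
  rw [e]
  refine (abs_add_le _ _).trans (add_le_add (by rwa [abs_neg]) ?_)
  rw [abs_mul, abs_of_pos (by positivity : 0 < α⁻¹)]
  have hinv : α⁻¹ ≤ 1 := inv_le_one_of_one_le₀ hα.le
  calc _ ≤ 1 * (t / 8) := by gcongr
    _ = t / 8 := one_mul _

theorem stmt6 (α : ℝ) (hα : 1 < α) (hirr : Irrational α) :
    Tendsto (fun t : ℝ =>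
        LBeatty α t - LBeatty α (2 * t)
          - (π ^ 2 / (12 * α * t) - (1 - α⁻¹) / 2 * Real.log 2))
      (𝓝[>] (0 : ℝ)) (𝓝 0) := by
  rw [Metric.tendsto_nhds]
  intro δ hδ
  have hl : 0 < Real.log 2 := Real.log_pos (by norm_num)
  obtain ⟨K, hK0, hK⟩ := main_bound α hα hirr (δ / (2 * Real.log 2)) (by positivity)
  have hlim : Tendsto (fun t : ℝ => δ / (2 * Real.log 2) * Real.log 2 + K * (Real.log 2 - fB t) + t / 8)
      (𝓝[>] (0 : ℝ)) (𝓝 (δ / (2 * Real.log 2) * Real.log 2 + K * (Real.log 2 - fB 0) + 0 / 8)) := by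
    have hc : Continuous (fun t : ℝ =>
        δ / (2 * Real.log 2) * Real.log 2 + K * (Real.log 2 - fB t) + t / 8) := by
      have := fB_cont
      fun_prop
    exact (hc.tendsto 0).mono_left nhdsWithin_le_nhds
  have hlt : δ / (2 * Real.log 2) * Real.log 2 + K * (Real.log 2 - fB 0) + 0 / 8 < δ := by
    rw [fB_zero]
    have : δ / (2 * Real.log 2) * Real.log 2 = δ / 2 := by field_simp
    rw [this]; linarith
  filter_upwards [hlim.eventually_lt_const hlt, self_mem_nhdsWithin] with t h1 h2
  rw [Real.dist_eq, sub_zero]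
  exact (hK t h2).trans_lt h1
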